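/- arXiv:1607.08602 — 8 statements merged into one kernel-verified Lean document; each statement's English description precedes it below -/
import Mathlib

section
/- Let k be a field, f ∈ k[x], and let u₁, v₁, u₂, v₂ ∈ k[x] with u₁, u₂ monic such that u₁ divides f − v₁² and u₂ divides f − v₂². Let w be the (monic) greatest common divisor of u₁, u₂, and v₁+v₂, and suppose c₁, c₂, c₃ ∈ k[x] satisfy w = c₁u₁ + c₂u₂ + c₃(v₁+v₂). Then: (i) w² divides u₁u₂; (ii) w divides c₁u₁v₂ + c₂u₂v₁ + c₃(v₁v₂ + f); and (iii) setting u₃ := u₁u₂/w² and v₃ := ((c₁u₁v₂ + c₂u₂v₁ + c₃(v₁v₂ + f))/w) mod u₃, the polynomial u₃ divides f − v₃². -/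
open Polynomial

/-- The composed numerator is congruent to `w * v₁` modulo `u₁`. -/
theorem dvd_composition_sub {R : Type*} [CommRing R] {f u₁ v₁ u₂ v₂ c₁ c₂ c₃ : R}
    (h₁ : u₁ ∣ f - v₁ ^ 2) :
    u₁ ∣ c₁ * u₁ * v₂ + c₂ * u₂ * v₁ + c₃ * (v₁ * v₂ + f)
      - (c₁ * u₁ + c₂ * u₂ + c₃ * (v₁ + v₂)) * v₁ := by
  obtain ⟨g, hg⟩ := h₁
  exact ⟨c₁ * (v₂ - v₁) + c₃ * g, by linear_combination c₃ * hg⟩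

/-- With `y ^ 2 = f`, the right-hand side is the norm of
`c₁ u₁ (v₂ - y) + c₂ u₂ (v₁ - y) + c₃ (v₁ - y) (v₂ - y)`, up to sign. -/
theorem mul_dvd_composition_norm {R : Type*} [CommRing R] {f u₁ v₁ u₂ v₂ c₁ c₂ c₃ : R}
    (h₁ : u₁ ∣ f - v₁ ^ 2) (h₂ : u₂ ∣ f - v₂ ^ 2) :
    u₁ * u₂ ∣ (c₁ * u₁ + c₂ * u₂ + c₃ * (v₁ + v₂)) ^ 2 * f
      - (c₁ * u₁ * v₂ + c₂ * u₂ * v₁ + c₃ * (v₁ * v₂ + f)) ^ 2 := by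
  obtain ⟨g₁, hg₁⟩ := h₁
  obtain ⟨g₂, hg₂⟩ := h₂
  have key : (c₁ * u₁ + c₂ * u₂ + c₃ * (v₁ + v₂)) ^ 2 * f
      - (c₁ * u₁ * v₂ + c₂ * u₂ * v₁ + c₃ * (v₁ * v₂ + f)) ^ 2 =
      c₁ ^ 2 * u₁ ^ 2 * (f - v₂ ^ 2) + c₂ ^ 2 * u₂ ^ 2 * (f - v₁ ^ 2)
      - c₃ ^ 2 * ((f - v₁ ^ 2) * (f - v₂ ^ 2)) + 2 * c₁ * c₂ * u₁ * u₂ * (f - v₁ * v₂)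
      + 2 * c₁ * c₃ * u₁ * v₁ * (f - v₂ ^ 2) + 2 * c₂ * c₃ * u₂ * v₂ * (f - v₁ ^ 2) := by
    ring
  rw [key, hg₁, hg₂]
  exact ⟨c₁ ^ 2 * u₁ * g₂ + c₂ ^ 2 * u₂ * g₁ - c₃ ^ 2 * g₁ * g₂ + 2 * c₁ * c₂ * (f - v₁ * v₂)
    + 2 * c₁ * c₃ * v₁ * g₂ + 2 * c₂ * c₃ * v₂ * g₁, by ring⟩

/-- Correctness of the composition step (Cantor composition) for semi-reduced Mumford
representations: with `w` the monic gcd of `u₁, u₂, v₁ + v₂` and Bézout coefficients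
`c₁, c₂, c₃`, we have (i) `w² ∣ u₁u₂`, (ii) `w ∣ c₁u₁v₂ + c₂u₂v₁ + c₃(v₁v₂ + f)`, and
(iii) `u₃ ∣ f − v₃²` where `u₃ = u₁u₂/w²` and
`v₃ = ((c₁u₁v₂ + c₂u₂v₁ + c₃(v₁v₂ + f))/w) mod u₃`. -/
theorem stmt_1 (k : Type*) [Field k] (f u₁ v₁ u₂ v₂ : k[X])
    (hu₁ : u₁.Monic) (hu₂ : u₂.Monic)
    (hdvd₁ : u₁ ∣ f - v₁ ^ 2) (hdvd₂ : u₂ ∣ f - v₂ ^ 2)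
    (w c₁ c₂ c₃ : k[X]) (hwmonic : w.Monic)
    (hw₁ : w ∣ u₁) (hw₂ : w ∣ u₂) (hw₃ : w ∣ v₁ + v₂)
    (hwgcd : ∀ d : k[X], d ∣ u₁ → d ∣ u₂ → d ∣ v₁ + v₂ → d ∣ w)
    (hbez : w = c₁ * u₁ + c₂ * u₂ + c₃ * (v₁ + v₂)) :
    w ^ 2 ∣ u₁ * u₂ ∧
    w ∣ c₁ * u₁ * v₂ + c₂ * u₂ * v₁ + c₃ * (v₁ * v₂ + f) ∧
    (u₁ * u₂ / w ^ 2) ∣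
      f - ((c₁ * u₁ * v₂ + c₂ * u₂ * v₁ + c₃ * (v₁ * v₂ + f)) / w %ₘ (u₁ * u₂ / w ^ 2)) ^ 2 := by
  have hw0 : w ≠ 0 := hwmonic.ne_zero
  have hsq : w ^ 2 ∣ u₁ * u₂ := pow_two w ▸ mul_dvd_mul hw₁ hw₂
  have hsub := hw₁.trans (dvd_composition_sub (u₂ := u₂) (v₂ := v₂) (c₁ := c₁) (c₂ := c₂)
    (c₃ := c₃) hdvd₁)
  have hnorm := mul_dvd_composition_norm (c₁ := c₁) (c₂ := c₂) (c₃ := c₃) hdvd₁ hdvd₂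
  rw [← hbez] at hsub hnorm
  have hnum := (dvd_sub_left (dvd_mul_right w v₁)).mp hsub
  refine ⟨hsq, hnum, ?_⟩
  obtain ⟨V, hV⟩ := hnum
  obtain ⟨u₃, hu₃⟩ := hsq
  rw [hV, hu₃] at hnorm ⊢
  rw [mul_div_cancel_left₀ V hw0, mul_div_cancel_left₀ u₃ (pow_ne_zero 2 hw0)]
  have hdvd : u₃ ∣ f - V ^ 2 := by
    refine (mul_dvd_mul_iff_left (pow_ne_zero 2 hw0)).mp ?_
    rwa [mul_sub, ← mul_pow]
  obtain ⟨q, hq⟩ : u₃ ∣ V - V %ₘ u₃ :=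
    ⟨V /ₘ u₃, by linear_combination -modByMonic_add_div V u₃⟩
  obtain ⟨r, hr⟩ := hdvd
  exact ⟨r + q * (V + V %ₘ u₃), by linear_combination hr + (V + V %ₘ u₃) * hq⟩
end

section
/- Let k be a field, let g ≥ 1, and let f ∈ k[x] have degree 2g+2. Suppose u, v ∈ k[x] with u monic, deg v < deg u, deg u ≥ g+2, u divides f − v², and f − v² ≠ 0. Then deg((f − v²)/u) ≤ deg u − 2. -/
open Polynomial

/-- Degree-decrease property of the reduction step: if `deg f = 2g+2`, `u` is monic with
`deg v < deg u` and `deg u ≥ g+2`, `u ∣ f − v²` and `f − v² ≠ 0`, then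
`deg((f − v²)/u) ≤ deg u − 2`. -/
theorem stmt_2 (k : Type*) [Field k] (g : ℕ) (hg : 1 ≤ g) (f u v : k[X])
    (hf : f.degree = (2 * g + 2 : ℕ)) (hu : u.Monic)
    (hv : v.degree < u.degree) (hud : g + 2 ≤ u.natDegree)
    (hdvd : u ∣ f - v ^ 2) (hne : f - v ^ 2 ≠ 0) :
    ((f - v ^ 2) / u).degree ≤ (u.natDegree - 2 : ℕ) := by
  obtain ⟨q, hq⟩ := hdvd
  have hvn : v.natDegree ≤ u.natDegree - 1 := by
    by_cases h0 : v = 0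
    · simp [h0]
    · have := natDegree_lt_natDegree h0 hv
      omega
  have hfn : f.natDegree = 2 * g + 2 := natDegree_eq_of_degree_eq_some hf
  have hv2 : (v ^ 2).natDegree ≤ 2 * u.natDegree - 2 := by
    rw [natDegree_pow]
    omega
  have hsub : (f - v ^ 2).natDegree ≤ 2 * u.natDegree - 2 :=
    natDegree_sub_le_of_le (by omega) hv2 |>.trans (max_self _).le
  have hq0 : q ≠ 0 := by
    rintro rfl
    exact hne (by rw [hq, mul_zero])
  rw [hq, hu.natDegree_mul' hq0] at hsub
  rw [hq, mul_div_cancel_left₀ q hu.ne_zero]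
  exact degree_le_of_natDegree_le (by omega)
end

section
/- Let k be a field, f ∈ k[x], and let u₁, u₂, v₁, s̃ ∈ k[x] with u₁, u₂ monic nonzero. Suppose u₁ divides f − v₁² and u₁u₂ divides f − (s̃u₁ + v₁)². Then u₂ divides (f − v₁²)/u₁ − s̃·(s̃u₁ + 2v₁), and (f − (s̃u₁ + v₁)²)/(u₁u₂) = ((f − v₁²)/u₁ − s̃·(s̃u₁ + 2v₁))/u₂. -/
open Polynomial

/-- Combining composition and the first reduction step in the typical addition case:
if `u₁ ∣ f − v₁²` and `u₁u₂ ∣ f − (s̃u₁ + v₁)²`, then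
`u₂ ∣ (f − v₁²)/u₁ − s̃(s̃u₁ + 2v₁)` and
`(f − (s̃u₁ + v₁)²)/(u₁u₂) = ((f − v₁²)/u₁ − s̃(s̃u₁ + 2v₁))/u₂`. -/
theorem stmt_8 (k : Type*) [Field k] (f u₁ u₂ v₁ s : k[X])
    (hu₁ : u₁.Monic) (hu₂ : u₂.Monic)
    (hdvd₁ : u₁ ∣ f - v₁ ^ 2) (hdvd₂ : u₁ * u₂ ∣ f - (s * u₁ + v₁) ^ 2) :
    u₂ ∣ (f - v₁ ^ 2) / u₁ - s * (s * u₁ + 2 * v₁) ∧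
    (f - (s * u₁ + v₁) ^ 2) / (u₁ * u₂) = ((f - v₁ ^ 2) / u₁ - s * (s * u₁ + 2 * v₁)) / u₂ := by
  obtain ⟨a, ha⟩ := hdvd₁
  obtain ⟨b, hb⟩ := hdvd₂
  have hquot : a - s * (s * u₁ + 2 * v₁) = u₂ * b :=
    mul_left_cancel₀ hu₁.ne_zero (by linear_combination hb - ha)
  rw [ha, hb, mul_div_cancel_left₀ _ hu₁.ne_zero, hquot,
    mul_div_cancel_left₀ _ (mul_ne_zero hu₁.ne_zero hu₂.ne_zero),
    mul_div_cancel_left₀ _ hu₂.ne_zero]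
  exact ⟨dvd_mul_right u₂ b, rfl⟩
end

section
/- Let k be a field, f ∈ k[x], and let u, v, t ∈ k[x] with u monic nonconstant, u dividing f − v², and t·(2v) ≡ 1 (mod u). Set s̃ := (((f − v²)/u)·t) mod u and v₃ := v + s̃·u. Then v₃ ≡ v (mod u) and u² divides f − v₃². -/
open Polynomial

/-- Correctness of the `u`-adic Newton iteration used in the doubling algorithm: if
`u ∣ f − v²` and `t·(2v) ≡ 1 (mod u)`, then with `s̃ = (((f − v²)/u)·t) mod u` and
`v₃ = v + s̃·u`, we have `v₃ ≡ v (mod u)` and `u² ∣ f − v₃²`. -/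
theorem stmt_9 (k : Type*) [Field k] (f u v t : k[X])
    (hu : u.Monic) (hud : 1 ≤ u.natDegree)
    (hdvd : u ∣ f - v ^ 2) (ht : u ∣ t * (2 * v) - 1) :
    u ∣ (v + ((f - v ^ 2) / u * t) %ₘ u * u) - v ∧
    u ^ 2 ∣ f - (v + ((f - v ^ 2) / u * t) %ₘ u * u) ^ 2 := by
  obtain ⟨q, hq⟩ := hdvd
  obtain ⟨w, hw⟩ := ht
  have hdiv : (f - v ^ 2) / u = q := by
    rw [hq, mul_div_cancel_left₀ _ hu.ne_zero]
  rw [hdiv]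
  have hmod := modByMonic_add_div (q * t) u
  set s := (q * t) %ₘ u
  set m := (q * t) /ₘ u
  refine ⟨⟨s, by ring⟩, ⟨2 * v * m - q * w - s ^ 2, ?_⟩⟩
  linear_combination hq - u * q * hw - 2 * v * u * hmod
end

section
/- Let k be a field of characteristic not 2, f ∈ k[x], and let u, v ∈ k[x] with u monic nonconstant, u dividing f − v², and u coprime to v (they generate the unit ideal of k[x]). Then there exists a polynomial v₃ ∈ k[x] with deg v₃ < 2·deg u such that v₃ ≡ v (mod u) and u² divides f − v₃²; moreover v₃ is unique among polynomials of degree < 2·deg u with these two properties. -/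
open Polynomial

/-- One Newton step: a square root of `f` modulo `u` lifts to one modulo `u ^ 2`. -/
theorem exists_sqrt_lift_sq {R : Type*} [CommRing R] {f u v : R} (h2 : IsUnit (2 : R))
    (hdvd : u ∣ f - v ^ 2) (hcop : IsCoprime u v) :
    ∃ w, u ∣ w - v ∧ u ^ 2 ∣ f - w ^ 2 := by
  obtain ⟨a, b, hab⟩ := hcop
  obtain ⟨q, hq⟩ := hdvd
  obtain ⟨c, hc⟩ := h2.exists_right_inv
  refine ⟨v + u * (c * b * q), ⟨c * b * q, by ring⟩, ⟨a * q - (c * b * q) ^ 2, ?_⟩⟩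
  linear_combination hq - u * v * b * q * hc - u * q * hab

/-- Two square roots of `f` modulo `u ^ 2` lifting the same `v` coprime to `u` agree
modulo `u ^ 2`. -/
theorem sq_dvd_sub_of_sqrt_lift {R : Type*} [CommRing R] {f u v y z : R}
    (h2 : IsUnit (2 : R)) (hcop : IsCoprime u v) (hy : u ∣ y - v) (hz : u ∣ z - v)
    (hfy : u ^ 2 ∣ f - y ^ 2) (hfz : u ^ 2 ∣ f - z ^ 2) : u ^ 2 ∣ y - z := by
  obtain ⟨s, hs⟩ := hy
  obtain ⟨t, ht⟩ := hz
  have hsum : y + z = 2 * v + u * (s + t) := by linear_combination hs + ht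
  have hcop' : IsCoprime u (y + z) := by
    rw [hsum]
    exact ((isCoprime_mul_unit_left_right h2 u v).2 hcop).add_mul_left_right _
  refine (hcop'.pow_left (m := 2)).dvd_of_dvd_mul_right ?_
  convert dvd_sub hfz hfy using 1
  ring

/-- A square root `v` of `f` modulo `u` with `gcd(u, v) = 1` lifts uniquely to a square
root of `f` modulo `u²`: there is a unique `v₃` with `deg v₃ < 2·deg u`, `v₃ ≡ v (mod u)`
and `u² ∣ f − v₃²`. -/
theorem stmt_10 (k : Type*) [Field k] (hchar : (2 : k) ≠ 0) (f u v : k[X])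
    (hu : u.Monic) (hud : 1 ≤ u.natDegree)
    (hdvd : u ∣ f - v ^ 2) (hcop : IsCoprime u v) :
    ∃! v₃ : k[X], v₃.degree < (2 * u.natDegree : ℕ) ∧ u ∣ v₃ - v ∧ u ^ 2 ∣ f - v₃ ^ 2 := by
  have h2 : IsUnit (2 : k[X]) := by
    rw [← map_ofNat (C : k →+* k[X]) 2]
    exact (IsUnit.mk0 (2 : k) hchar).map C
  have hu2 : (u ^ 2).Monic := hu.pow 2
  have hdeg : (u ^ 2).degree = (2 * u.natDegree : ℕ) := by
    rw [degree_eq_natDegree hu2.ne_zero, hu.natDegree_pow]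
  obtain ⟨w, hwv, hwf⟩ := exists_sqrt_lift_sq h2 hdvd hcop
  have hmod : u ^ 2 ∣ w %ₘ u ^ 2 - w := dvd_modByMonic_sub w (u ^ 2)
  refine ⟨w %ₘ u ^ 2, ⟨hdeg ▸ degree_modByMonic_lt w hu2, ?_, ?_⟩, ?_⟩
  · simpa using dvd_add ((dvd_pow_self u two_ne_zero).trans hmod) hwv
  · convert dvd_sub hwf (hmod.mul_right (w %ₘ u ^ 2 + w)) using 1
    ring
  · rintro y ⟨hyd, hyv, hyf⟩
    have hdvd' := sq_dvd_sub_of_sqrt_lift h2 hcop hyv hwv hyf hwf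
    have hsub : u ^ 2 ∣ y - w %ₘ u ^ 2 := by
      convert dvd_sub hdvd' hmod using 1
      ring
    refine sub_eq_zero.1 (eq_zero_of_dvd_of_degree_lt hsub ?_)
    exact (degree_sub_le _ _).trans_lt
      (max_lt (hdeg ▸ hyd) (degree_modByMonic_lt w hu2))
end

section
/- Let k be a field, and let f ∈ k[x] be monic of degree 8 with coefficient of x⁷ equal to 0. Let u₁ = x³ + u₁₂x² + u₁₁x + u₁₀ and u₂ = x³ + u₂₂x² + u₂₁x + u₂₀ be monic cubics with u₁, u₂ coprime, and let v₁, v₂ ∈ k[x] of degree ≤ 2 satisfy u₁ | f − v₁² and u₂ | f − v₂². Let t ∈ k[x] satisfy t·u₁ ≡ 1 (mod u₂), set s̃ := ((v₂ − v₁)·t) mod u₂, and assume deg s̃ = 2 with leading coefficient lc(s̃) ≠ 0. Put c := lc(s̃)⁻¹, s := c·s̃ = x² + s₁x + s₀, z := s·u₁, w := (f − v₁²)/u₁, u₄ := (s·(z + 2c·v₁) − c²·w)/u₂ (this division being exact), and ṽ₄ := v₁ + u₄ + c⁻¹·(z mod u₄). Then u₄ is monic of degree 4, ṽ₄ is monic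 of degree 4, and the coefficient of x³ in ṽ₄ equals u₁₂ − u₂₂ + c + 2s₁ + c⁻¹·(u₂₁ + s₁(s₁ − u₂₂) − s₀). -/
open Polynomial

/-- The remainder of a monic quintic modulo a monic quartic has the `X ^ 3`-coefficient given by
two steps of long division. -/
theorem coeff_three_modByMonic_of_quintic_of_quartic {R : Type*} [CommRing R] [Nontrivial R]
    {p q : R[X]} (hp : p.Monic) (hpd : p.natDegree = 5) (hq : q.Monic) (hqd : q.natDegree = 4) :
    (p %ₘ q).coeff 3 =
      p.coeff 3 - q.coeff 2 - q.coeff 3 * (p.coeff 4 - q.coeff 3) := by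
  have hr : (p %ₘ q).natDegree < 4 :=
    hqd ▸ natDegree_modByMonic_lt p hq (by rintro rfl; simp at hqd)
  have hd : (p /ₘ q).natDegree = 1 := by rw [natDegree_divByMonic p hq, hpd, hqd]
  have hq4 : q.coeff 4 = 1 := hqd ▸ hq.coeff_natDegree
  have hp5 : p.coeff 5 = 1 := hpd ▸ hp.coeff_natDegree
  have hq_zero (n : ℕ) (hn : 4 < n) : q.coeff n = 0 :=
    coeff_eq_zero_of_natDegree_lt (hqd ▸ hn)
  have hd_zero (n : ℕ) (hn : 1 < n) : (p /ₘ q).coeff n = 0 :=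
    coeff_eq_zero_of_natDegree_lt (hd ▸ hn)
  have hr_zero (n : ℕ) (hn : 4 ≤ n) : (p %ₘ q).coeff n = 0 :=
    coeff_eq_zero_of_natDegree_lt (hr.trans_le hn)
  have hdiv (n : ℕ) : (p %ₘ q).coeff n + (q * (p /ₘ q)).coeff n = p.coeff n := by
    rw [← coeff_add, modByMonic_add_div p q]
  have h5 := hdiv 5
  have h4 := hdiv 4
  have h3 := hdiv 3
  simp [coeff_mul, Finset.Nat.antidiagonal_succ, hq_zero, hd_zero, hr_zero, hq4, hp5] at h5 h4 h3
  rw [h5] at h4 h3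
  linear_combination h3 - q.coeff 3 * h4

/-- Equation (1) of the paper: in the typical addition case, `u₄` and `ṽ₄` are monic of
degree 4 and the `x³`-coefficient of `ṽ₄` is
`u₁₂ − u₂₂ + c + 2s₁ + c⁻¹(u₂₁ + s₁(s₁ − u₂₂) − s₀)`.
Here `st` stands for `s̃` and `vt` for `ṽ₄`. -/
theorem stmt_14 (k : Type*) [Field k] (f u₁ u₂ v₁ v₂ t : k[X])
    (hf : f.Monic) (hfd : f.natDegree = 8) (hf7 : f.coeff 7 = 0)
    (hu₁ : u₁.Monic) (hu₁d : u₁.natDegree = 3)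
    (hu₂ : u₂.Monic) (hu₂d : u₂.natDegree = 3)
    (hcop : IsCoprime u₁ u₂)
    (hv₁ : v₁.degree ≤ 2) (hv₂ : v₂.degree ≤ 2)
    (hdvd₁ : u₁ ∣ f - v₁ ^ 2) (hdvd₂ : u₂ ∣ f - v₂ ^ 2)
    (ht : u₂ ∣ t * u₁ - 1)
    (st : k[X]) (hst : st = ((v₂ - v₁) * t) %ₘ u₂)
    (hstd : st.natDegree = 2) (hlc : st.coeff 2 ≠ 0)
    (c : k) (hc : c = (st.coeff 2)⁻¹)
    (s : k[X]) (hs : s = C c * st)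
    (z : k[X]) (hz : z = s * u₁)
    (w : k[X]) (hw : w = (f - v₁ ^ 2) / u₁)
    (hexact : u₂ ∣ s * (z + C (2 * c) * v₁) - C (c ^ 2) * w)
    (u₄ : k[X]) (hu₄ : u₄ = (s * (z + C (2 * c) * v₁) - C (c ^ 2) * w) / u₂)
    (vt : k[X]) (hvt : vt = v₁ + u₄ + C c⁻¹ * (z %ₘ u₄)) :
    u₄.Monic ∧ u₄.natDegree = 4 ∧ vt.Monic ∧ vt.natDegree = 4 ∧
    vt.coeff 3 = u₁.coeff 2 - u₂.coeff 2 + c + 2 * s.coeff 1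
      + c⁻¹ * (u₂.coeff 1 + s.coeff 1 * (s.coeff 1 - u₂.coeff 2) - s.coeff 0) := by
  have hc0 : c ≠ 0 := hc ▸ inv_ne_zero hlc
  have hsd : s.natDegree = 2 := by rw [hs, natDegree_C_mul hc0, hstd]
  have hs2 : s.coeff 2 = 1 := by rw [hs, coeff_C_mul, hc, inv_mul_cancel₀ hlc]
  have hsm : s.Monic := by rw [Monic, leadingCoeff, hsd, hs2]
  have hzm : z.Monic := hz ▸ hsm.mul hu₁
  have hzd : z.natDegree = 5 := by rw [hz, hsm.natDegree_mul hu₁, hsd, hu₁d]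
  have hv₁d : v₁.natDegree ≤ 2 := natDegree_le_of_degree_le hv₁
  have hv₁sq : (v₁ ^ 2).natDegree < f.natDegree := by
    have := natDegree_pow_le_of_le 2 hv₁d
    lia
  have hfv₁m : (f - v₁ ^ 2).Monic := hf.sub_of_left (degree_lt_degree hv₁sq)
  have hfv₁d : (f - v₁ ^ 2).natDegree = 8 := by
    rw [natDegree_sub_eq_left_of_natDegree_lt hv₁sq, hfd]
  have hw_mul : u₁ * w = f - v₁ ^ 2 := by
    rw [hw, EuclideanDomain.mul_div_cancel' hu₁.ne_zero hdvd₁]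
  have hwm : w.Monic := hu₁.of_mul_monic_left (hw_mul ▸ hfv₁m)
  have hwd : w.natDegree = 5 := by
    have := hu₁.natDegree_mul hwm
    rw [hw_mul] at this
    lia
  have hw5 : w.coeff 5 = 1 := hwd ▸ hwm.coeff_natDegree
  have hu₁3 : u₁.coeff 3 = 1 := hu₁d ▸ hu₁.coeff_natDegree
  have hu₂3 : u₂.coeff 3 = 1 := hu₂d ▸ hu₂.coeff_natDegree
  have hN_mul : u₂ * u₄ = s * z + (C (2 * c) * (s * v₁) - C (c ^ 2) * w) := by
    rw [hu₄, EuclideanDomain.mul_div_cancel' hu₂.ne_zero hexact]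
    ring
  have hsz : (s * z).Monic := hsm.mul hzm
  have hszd : (s * z).natDegree = 7 := by rw [hsm.natDegree_mul hzm, hsd, hzd]
  have hlow : (C (2 * c) * (s * v₁) - C (c ^ 2) * w).natDegree < (s * z).natDegree := by
    have h₁ : (C (2 * c) * (s * v₁)).natDegree ≤ 5 :=
      (natDegree_C_mul_le _ _).trans (natDegree_mul_le.trans (by lia))
    have h₂ : (C (c ^ 2) * w).natDegree ≤ 5 := (natDegree_C_mul_le _ _).trans hwd.le
    have := natDegree_sub_le_of_le h₁ h₂
    lia
  have hu₄m : u₄.Monic :=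
    hu₂.of_mul_monic_left (hN_mul ▸ hsz.add_of_left (degree_lt_degree hlow))
  have hu₄d : u₄.natDegree = 4 := by
    have := hu₂.natDegree_mul hu₄m
    rw [hN_mul, natDegree_add_eq_left_of_natDegree_lt hlow] at this
    lia
  have hu₄4 : u₄.coeff 4 = 1 := hu₄d ▸ hu₄m.coeff_natDegree
  have hs_zero (n : ℕ) (hn : 2 < n) : s.coeff n = 0 := coeff_eq_zero_of_natDegree_lt (hsd ▸ hn)
  have hv₁_zero (n : ℕ) (hn : 2 < n) : v₁.coeff n = 0 :=
    coeff_eq_zero_of_natDegree_lt (hv₁d.trans_lt hn)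
  have hu₁_zero (n : ℕ) (hn : 3 < n) : u₁.coeff n = 0 :=
    coeff_eq_zero_of_natDegree_lt (hu₁d ▸ hn)
  have hu₂_zero (n : ℕ) (hn : 3 < n) : u₂.coeff n = 0 :=
    coeff_eq_zero_of_natDegree_lt (hu₂d ▸ hn)
  have hu₄_zero (n : ℕ) (hn : 4 < n) : u₄.coeff n = 0 :=
    coeff_eq_zero_of_natDegree_lt (hu₄d ▸ hn)
  have hw_zero (n : ℕ) (hn : 5 < n) : w.coeff n = 0 :=
    coeff_eq_zero_of_natDegree_lt (hwd ▸ hn)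
  have hz_zero (n : ℕ) (hn : 5 < n) : z.coeff n = 0 :=
    coeff_eq_zero_of_natDegree_lt (hzd ▸ hn)
  have hz5 : z.coeff 5 = 1 := hzd ▸ hzm.coeff_natDegree
  have hz4 : z.coeff 4 = u₁.coeff 2 + s.coeff 1 := by
    simp [hz, coeff_mul, Finset.Nat.antidiagonal_succ, hs_zero, hu₁_zero, hs2, hu₁3]
    ring
  have hz3 : z.coeff 3 = u₁.coeff 1 + s.coeff 1 * u₁.coeff 2 + s.coeff 0 := by
    simp [hz, coeff_mul, Finset.Nat.antidiagonal_succ, hs_zero, hs2, hu₁3]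
    ring
  have h6 := congrArg (coeff · 6) hN_mul
  have h5 := congrArg (coeff · 5) hN_mul
  simp only [coeff_add, coeff_sub, coeff_C_mul] at h6 h5
  simp [coeff_mul, Finset.Nat.antidiagonal_succ, hs_zero, hv₁_zero, hu₂_zero, hu₄_zero, hw_zero,
    hz_zero, hs2, hu₂3, hu₄4, hw5, hz5] at h6 h5
  have hr3 := coeff_three_modByMonic_of_quintic_of_quartic hzm hzd hu₄m hu₄d
  have hrd : (z %ₘ u₄).natDegree < 4 :=
    hu₄d ▸ natDegree_modByMonic_lt z hu₄m (by rintro rfl; simp at hu₄d)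
  have hvt' : vt = u₄ + (v₁ + C c⁻¹ * (z %ₘ u₄)) := by rw [hvt]; ring
  have hvlow : (v₁ + C c⁻¹ * (z %ₘ u₄)).natDegree < u₄.natDegree := by
    have h₁ := natDegree_C_mul_le c⁻¹ (z %ₘ u₄)
    have h₂ := natDegree_add_le v₁ (C c⁻¹ * (z %ₘ u₄))
    lia
  refine ⟨hu₄m, hu₄d, hvt' ▸ hu₄m.add_of_left (degree_lt_degree hvlow), ?_, ?_⟩
  · rw [hvt', natDegree_add_eq_left_of_natDegree_lt hvlow, hu₄d]
  · have ha3 : u₄.coeff 3 = u₁.coeff 2 - u₂.coeff 2 + 2 * s.coeff 1 := by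
      linear_combination h6 + hz4
    have ha2 : (z %ₘ u₄).coeff 3 =
        c ^ 2 + (u₂.coeff 1 + s.coeff 1 * (s.coeff 1 - u₂.coeff 2) - s.coeff 0) := by
      rw [hz4, hz3, ha3] at hr3
      rw [hz3, hz4, ha3] at h5
      linear_combination hr3 - h5
    rw [hvt, coeff_add, coeff_add, coeff_C_mul, hv₁_zero 3 (by simp), ha3, ha2]
    field_simp
    ring
end

section
/- Let k be a field, and let f ∈ k[x] be monic of degree 8 with coefficient of x⁷ equal to 0; write f₆ for its coefficient of x⁶. Let V ∈ k[x] be monic of degree 4 with coefficient of x³ equal to 0 and deg(f − V²) ≤ 3. Let u₁ = x³ + u₁₂x² + u₁₁x + u₁₀ be a monic cubic, let v₁ = v₁₂x² + v₁₁x + v₁₀ have degree ≤ 2 with u₁ dividing f − v₁², and set ṽ₁ := v₁ − V + (V mod u₁). Then u₁ divides f − ṽ₁², the quotient (f − ṽ₁²)/u₁ has degree at most 3, and its coefficient of x³ equals f₆ + 2(v₁₂ + u₁₂² − u₁₁). -/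
open Polynomial

/-- Correctness of the degree and leading-coefficient claim underlying the typical
negation formula: with `ṽ₁ = v₁ − V + (V mod u₁)`, `u₁` divides `f − ṽ₁²`, the quotient
has degree at most 3, and its `x³`-coefficient is `f₆ + 2(v₁₂ + u₁₂² − u₁₁)`.
Here `vt` stands for `ṽ₁`. -/
theorem stmt_18 (k : Type*) [Field k] (f V u₁ v₁ : k[X])
    (hf : f.Monic) (hfd : f.natDegree = 8) (hf7 : f.coeff 7 = 0)
    (hV : V.Monic) (hVd : V.natDegree = 4) (hV3 : V.coeff 3 = 0)
    (hVf : (f - V ^ 2).degree ≤ 3)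
    (hu : u₁.Monic) (hud : u₁.natDegree = 3)
    (hv : v₁.degree ≤ 2) (hdvd : u₁ ∣ f - v₁ ^ 2)
    (vt : k[X]) (hvt : vt = v₁ - V + V %ₘ u₁) :
    u₁ ∣ f - vt ^ 2 ∧ ((f - vt ^ 2) / u₁).degree ≤ 3 ∧
    ((f - vt ^ 2) / u₁).coeff 3
      = f.coeff 6 + 2 * (v₁.coeff 2 + (u₁.coeff 2) ^ 2 - u₁.coeff 1) := by
  have coeff_zero_of_natDegree_le {p : k[X]} {n : ℕ} (h : p.natDegree ≤ n) (m : ℕ)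
      (hm : n < m) : p.coeff m = 0 := coeff_eq_zero_of_natDegree_lt (h.trans_lt hm)
  have hdiv := modByMonic_add_div V u₁
  have hrd : (V %ₘ u₁).natDegree ≤ 2 := by
    have := natDegree_modByMonic_lt V hu (by rintro rfl; simp at hud)
    omega
  have hqd : (V /ₘ u₁).natDegree ≤ 1 := by
    rw [natDegree_divByMonic V hu, hVd, hud]
  have hvd : v₁.natDegree ≤ 2 := natDegree_le_of_degree_le hv
  have hfVd : (f - V ^ 2).natDegree ≤ 3 := natDegree_le_of_degree_le hVf
  subst hvt
  generalize V %ₘ u₁ = r at *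
  generalize V /ₘ u₁ = q at *
  have hu3 : u₁.coeff 3 = 1 := hud ▸ hu.coeff_natDegree
  have hV4 : V.coeff 4 = 1 := hVd ▸ hV.coeff_natDegree
  obtain ⟨c, d, rfl⟩ := exists_eq_X_add_C_of_natDegree_le_one hqd
  have hcoeff (n : ℕ) :
      V.coeff (n + 1) = r.coeff (n + 1) + (c * u₁.coeff n + d * u₁.coeff (n + 1)) := by
    rw [← hdiv, show u₁ * (C c * X + C d) = C c * (u₁ * X) + C d * u₁ by ring]
    simp only [coeff_add, coeff_C_mul, coeff_mul_X]
  have hc : c = 1 := by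
    have h := hcoeff 3
    rw [hV4, hu3, coeff_zero_of_natDegree_le hrd 4 (by norm_num),
      coeff_zero_of_natDegree_le hud.le 4 (by norm_num)] at h
    linear_combination -h
  have hd : d = -u₁.coeff 2 := by
    have h := hcoeff 2
    rw [hV3, hu3, coeff_zero_of_natDegree_le hrd 3 (by norm_num), hc] at h
    linear_combination -h
  have hr2 : r.coeff 2 = V.coeff 2 + u₁.coeff 2 ^ 2 - u₁.coeff 1 := by
    have h := hcoeff 1
    rw [hc, hd] at h
    linear_combination -h
  have hf6 : f.coeff 6 = 2 * V.coeff 2 := by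
    have h := coeff_zero_of_natDegree_le hfVd 6 (by norm_num)
    have h5 := coeff_zero_of_natDegree_le hVd.le 5 (by norm_num)
    have h6 := coeff_zero_of_natDegree_le hVd.le 6 (by norm_num)
    simp [pow_two, coeff_mul, Finset.Nat.antidiagonal_succ, hV3, hV4, h5, h6] at h
    linear_combination h
  have hsplit : f - (v₁ - V + r) ^ 2 = (f - V ^ 2) + (2 * V - (v₁ + r)) * (v₁ + r) := by ring
  have hsd : (v₁ + r).natDegree ≤ 2 := natDegree_add_le_of_degree_le hvd hrd
  have htd : (2 * V - (v₁ + r)).natDegree ≤ 4 := by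
    refine (natDegree_sub_le _ _).trans (max_le ?_ (hsd.trans (by norm_num)))
    rw [two_mul]
    exact natDegree_add_le_of_degree_le hVd.le hVd.le
  have hgd : (f - (v₁ - V + r) ^ 2).natDegree ≤ 6 := by
    rw [hsplit]
    exact natDegree_add_le_of_degree_le (hfVd.trans (by norm_num))
      (natDegree_mul_le_of_le htd hsd)
  have hg6 : (f - (v₁ - V + r) ^ 2).coeff 6
      = f.coeff 6 + 2 * (v₁.coeff 2 + u₁.coeff 2 ^ 2 - u₁.coeff 1) := by
    rw [hsplit, coeff_add, coeff_zero_of_natDegree_le hfVd 6 (by norm_num),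
      show (6 : ℕ) = 4 + 2 from rfl, coeff_mul_add_eq_of_natDegree_le htd hsd, coeff_sub,
      coeff_zero_of_natDegree_le hsd 4 (by norm_num), two_mul V, coeff_add, coeff_add, hV4,
      hr2, hf6]
    ring
  have hgdvd : u₁ ∣ f - (v₁ - V + r) ^ 2 := by
    obtain ⟨w, hw⟩ := hdvd
    refine ⟨w + (C c * X + C d) * (v₁ + (v₁ - V + r)), ?_⟩
    linear_combination hw - (2 * v₁ - V + r) * hdiv
  refine ⟨hgdvd, ?_⟩
  obtain ⟨Q, hQ⟩ := hgdvd
  rw [hQ] at hgd hg6 ⊢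
  rw [mul_div_cancel_left₀ Q hu.ne_zero]
  have hQd : Q.natDegree ≤ 3 := by
    rcases eq_or_ne Q 0 with rfl | hQ0
    · simp
    · rw [hu.natDegree_mul' hQ0, hud] at hgd
      omega
  refine ⟨degree_le_of_natDegree_le hQd, ?_⟩
  rw [← hg6, show (6 : ℕ) = 3 + 3 from rfl, coeff_mul_add_eq_of_natDegree_le hud.le hQd, hu3, one_mul]
end

section
/- Let k be a field, and let u₁ = x³ + u₁₂x² + u₁₁x + u₁₀ and u₂ = x³ + u₂₂x² + u₂₁x + u₂₀ be monic cubics in k[x]. Define t₁ := u₁₀ − u₂₀, t₂ := u₁₁ − u₂₁, w₀ := u₁₂ − u₂₂, t₃ := t₂ − u₂₂w₀, t₄ := t₁ − u₂₁w₀, t₅ := u₂₂t₃ − t₄, t₆ := u₂₀w₀ + u₂₁t₃, i₀ := t₄t₅ − t₃t₆, i₁ := w₀t₆ − t₂t₅, i₂ := w₀t₄ − t₂t₃, and r := t₁i₀ − u₂₀(t₃i₂ + w₀i₁). Then, with i(x) := i₂x² + i₁x + i₀, one has i·u₁ ≡ r (mod u₂), and r equals the resultant Res(u₁, u₂). -/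
open Polynomial

/-- The resultant `Res(u₁, u₂)` of two monic cubic polynomials
`u₁ = x³ + a₂x² + a₁x + a₀` and `u₂ = x³ + b₂x² + b₁x + b₀`, given as the determinant of
their 6×6 Sylvester matrix. -/
noncomputable def cubicResultant {k : Type*} [Field k] (u₁ u₂ : k[X]) : k :=
  Matrix.det
    !![1, u₁.coeff 2, u₁.coeff 1, u₁.coeff 0, 0, 0;
       0, 1, u₁.coeff 2, u₁.coeff 1, u₁.coeff 0, 0;
       0, 0, 1, u₁.coeff 2, u₁.coeff 1, u₁.coeff 0;
       1, u₂.coeff 2, u₂.coeff 1, u₂.coeff 0, 0, 0;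
       0, 1, u₂.coeff 2, u₂.coeff 1, u₂.coeff 0, 0;
       0, 0, 1, u₂.coeff 2, u₂.coeff 1, u₂.coeff 0]

theorem Polynomial.Monic.eq_cubic {R : Type*} [Semiring R] {p : R[X]} (hp : p.Monic)
    (hd : p.natDegree = 3) :
    p = X ^ 3 + C (p.coeff 2) * X ^ 2 + C (p.coeff 1) * X + C (p.coeff 0) := by
  have h3 : p.coeff 3 = 1 := hd ▸ hp.coeff_natDegree
  conv_lhs => rw [p.as_sum_range_C_mul_X_pow, hd]
  simp only [Finset.sum_range_succ, Finset.sum_range_zero, h3, C_1, pow_zero, pow_one, mul_one,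
    one_mul, zero_add]
  abel

/-- Correctness of step 1 of the explicit TypicalAddition formula: the straight-line code
computes `r = Res(u₁, u₂)` and the almost inverse `i = r·u₁⁻¹ mod u₂`, i.e.
`i·u₁ ≡ r (mod u₂)` and `r` is the resultant of `u₁` and `u₂`. -/
theorem stmt_19 (k : Type*) [Field k] (u₁ u₂ : k[X])
    (hu₁ : u₁.Monic) (hu₁d : u₁.natDegree = 3)
    (hu₂ : u₂.Monic) (hu₂d : u₂.natDegree = 3)
    (t₁ t₂ w₀ t₃ t₄ t₅ t₆ i₀ i₁ i₂ r : k)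
    (ht₁ : t₁ = u₁.coeff 0 - u₂.coeff 0)
    (ht₂ : t₂ = u₁.coeff 1 - u₂.coeff 1)
    (hw₀ : w₀ = u₁.coeff 2 - u₂.coeff 2)
    (ht₃ : t₃ = t₂ - u₂.coeff 2 * w₀)
    (ht₄ : t₄ = t₁ - u₂.coeff 1 * w₀)
    (ht₅ : t₅ = u₂.coeff 2 * t₃ - t₄)
    (ht₆ : t₆ = u₂.coeff 0 * w₀ + u₂.coeff 1 * t₃)
    (hi₀ : i₀ = t₄ * t₅ - t₃ * t₆)
    (hi₁ : i₁ = w₀ * t₆ - t₂ * t₅)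
    (hi₂ : i₂ = w₀ * t₄ - t₂ * t₃)
    (hr : r = t₁ * i₀ - u₂.coeff 0 * (t₃ * i₂ + w₀ * i₁)) :
    u₂ ∣ (C i₂ * X ^ 2 + C i₁ * X + C i₀) * u₁ - C r ∧
    r = cubicResultant u₁ u₂ := by
  constructor
  · refine ⟨C i₂ * X ^ 2 + (C i₁ + C (i₂ * w₀)) * X + C (i₀ + i₂ * t₃ + i₁ * w₀), ?_⟩
    have h₁ := hu₁.eq_cubic hu₁d
    have h₂ := hu₂.eq_cubic hu₂d
    generalize u₁.coeff 0 = a₀, u₁.coeff 1 = a₁, u₁.coeff 2 = a₂ at *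
    generalize u₂.coeff 0 = b₀, u₂.coeff 1 = b₁, u₂.coeff 2 = b₂ at *
    subst h₁ h₂ hr hi₀ hi₁ hi₂ ht₅ ht₆ ht₃ ht₄ ht₁ ht₂ hw₀
    simp only [map_add, map_sub, map_mul]
    ring
  · subst hr hi₀ hi₁ hi₂ ht₅ ht₆ ht₃ ht₄ ht₁ ht₂ hw₀
    rw [cubicResultant]
    simp [Matrix.det_succ_row_zero, Fin.sum_univ_succ, Fin.succAbove]
    ring
end
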